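/- For all s,t ∈ ℕ and all n ≥ 1, the bilinear identity τ_n^{s,t}·τ_n^{s+1,t+1} − τ_{n+1}^{s,t}·τ_{n−1}^{s+1,t+1} = ξ_n^{s,t+1}·ξ_n^{s,t} − σ_{n−1}^{s+1,t}·σ_n^{s,t} holds. -/

import Mathlib

open MeasureTheory

/-- Bimoments `m_{i,j}^{s,t}` of the Cauchy-Jacobi weight. -/
noncomputable def mom (s t i j : ℕ) : ℝ :=
  ∫ p in (Set.Ioo (0:ℝ) 1 ×ˢ Set.Ioo (0:ℝ) 1),
    (p.1 ^ (s + i) * p.2 ^ (s + j) / (p.1 + p.2)) *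
      ((1 - p.1) / (1 + p.1)) ^ t * ((1 - p.2) / (1 + p.2)) ^ t

/-- Single moments `φ_i^{s,t} = L_{s,t}(x^i)`. -/
noncomputable def phi (s t i : ℕ) : ℝ :=
  Real.sqrt 2 * ∫ x in Set.Ioo (0:ℝ) 1,
    (x ^ (s + i) / (1 + x)) * ((1 - x) / (1 + x)) ^ t

/-- Single moments `m_i^{s,t}`. -/
noncomputable def momS (s t i : ℕ) : ℝ :=
  ∫ x in Set.Ioo (0:ℝ) 1, x ^ (s + i) * ((1 - x) / (1 + x)) ^ t

/-- `τ_n^{s,t} = det(m_{i,j}^{s,t})_{i,j=0}^{n-1}` (with `τ_0^{s,t} = 1`). -/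
noncomputable def tau (s t n : ℕ) : ℝ :=
  Matrix.det (Matrix.of fun i j : Fin n => mom s t i j)

/-- `ξ_n^{s,t} = det(m_{i,j+1}^{s,t})_{i,j=0}^{n-1}` (with `ξ_0^{s,t} = 1`). -/
noncomputable def xi (s t n : ℕ) : ℝ :=
  Matrix.det (Matrix.of fun i j : Fin n => mom s t i ((j : ℕ) + 1))

/-- `σ_n^{s,t}`: determinant of the `(n+1)×(n+1)` matrix with first `n` columns the
bimoments and last column `(φ_0^{s,t},…,φ_n^{s,t})`. -/
noncomputable def sig (s t n : ℕ) : ℝ :=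
  Matrix.det (Matrix.of fun i j : Fin (n + 1) =>
    if (j : ℕ) < n then mom s t i j else phi s t i)

/-- `ψ_n^{s,t}`: like `σ_n^{s,t}` but with shifted bimoments `m_{i,j+1}^{s,t}`. -/
noncomputable def psi (s t n : ℕ) : ℝ :=
  Matrix.det (Matrix.of fun i j : Fin (n + 1) =>
    if (j : ℕ) < n then mom s t i ((j : ℕ) + 1) else phi s t i)

/-- `σ̃_n^{s,t}`: determinant of the `(n+1)×(n+1)` matrix with first `n` columns the
bimoments and last column the single moments `(m_0^{s,t},…,m_n^{s,t})`. -/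
noncomputable def sigT (s t n : ℕ) : ℝ :=
  Matrix.det (Matrix.of fun i j : Fin (n + 1) =>
    if (j : ℕ) < n then mom s t i j else momS s t i)

/-- `τ̃_n^{s,t}`: determinant of the `n×n` matrix whose rows are the bimoment rows
`i = 0,…,n−2,n`. -/
noncomputable def tauT (s t n : ℕ) : ℝ :=
  Matrix.det (Matrix.of fun i j : Fin n =>
    mom s t (if (i : ℕ) < n - 1 then (i : ℕ) else n) j)

/-- The monic Cauchy-Jacobi orthogonal polynomial `P_n^{s,t}` (as a real function). -/
noncomputable def P (s t n : ℕ) (x : ℝ) : ℝ :=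
  (1 / tau s t n) * Matrix.det (Matrix.of fun i j : Fin (n + 1) =>
    if (j : ℕ) < n then mom s t i j else x ^ (i : ℕ))

/-- The adjacent monic polynomial `Q_n^{s,t}` (as a real function). -/
noncomputable def Q (s t n : ℕ) (x : ℝ) : ℝ :=
  (1 / xi s t n) * Matrix.det (Matrix.of fun i j : Fin (n + 1) =>
    if (j : ℕ) < n then mom s t i ((j : ℕ) + 1) else x ^ (i : ℕ))

/-- The auxiliary monic polynomial `R_n^{s,t}` (as a real function): first column
`(φ_0,…,φ_n)`, next `n−1` columns the bimoments `m_{i,j}` for `j = 0,…,n−2`,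
last column `(1,x,…,x^n)`, normalized by `(−1)^{n−1}/σ_{n−1}^{s,t}`. -/
noncomputable def R (s t n : ℕ) (x : ℝ) : ℝ :=
  ((-1 : ℝ) ^ (n - 1) / sig s t (n - 1)) *
    Matrix.det (Matrix.of fun i j : Fin (n + 1) =>
      if (j : ℕ) = 0 then phi s t i
      else if (j : ℕ) < n then mom s t i ((j : ℕ) - 1) else x ^ (i : ℕ))

/-- The two-parameter deformed Cauchy inner product `⟨f,g⟩_{s,t}` on real functions. -/
noncomputable def innerF (s t : ℕ) (f g : ℝ → ℝ) : ℝ :=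
  ∫ p in (Set.Ioo (0:ℝ) 1 ×ˢ Set.Ioo (0:ℝ) 1),
    (p.1 ^ s * p.2 ^ s / (p.1 + p.2)) * f p.1 * g p.2 *
      ((1 - p.1) / (1 + p.1)) ^ t * ((1 - p.2) / (1 + p.2)) ^ t

/-- The two-parameter deformed Cauchy inner product on real polynomials. -/
noncomputable def innerP (s t : ℕ) (f g : Polynomial ℝ) : ℝ :=
  innerF s t (fun x => f.eval x) (fun y => g.eval y)

/-- The linear functional `L_{s,t}` on real functions. -/
noncomputable def LF (s t : ℕ) (f : ℝ → ℝ) : ℝ :=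
  Real.sqrt 2 * ∫ x in Set.Ioo (0:ℝ) 1,
    (x ^ s / (1 + x)) * f x * ((1 - x) / (1 + x)) ^ t

/-- The linear functional `L_{s,t}` on real polynomials. -/
noncomputable def LP (s t : ℕ) (f : Polynomial ℝ) : ℝ := LF s t (fun x => f.eval x)

/-- The determinant of the matrix of values of a kernel `E` at given row and column labels. -/
noncomputable def labelDet {α ι : Type*} [Fintype ι] [DecidableEq ι]
    (E : α → α → ℝ) (r c : ι → α) : ℝ :=
  Matrix.det (Matrix.of fun i j => E (r i) (c j))

lemma labelDet_comp_equiv {α ι κ : Type*} [Fintype ι] [DecidableEq ι] [Fintype κ] [DecidableEq κ]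
    (E : α → α → ℝ) (r c : ι → α) (e : κ ≃ ι) :
    labelDet E (r ∘ e) (c ∘ e) = labelDet E r c :=
  Matrix.det_submatrix_equiv_self e (Matrix.of fun i j => E (r i) (c j))

lemma labelDet_comp_perm {α ι : Type*} [Fintype ι] [DecidableEq ι]
    (E : α → α → ℝ) (r c : ι → α) (π : Equiv.Perm ι) :
    labelDet E (r ∘ π) c = (Equiv.Perm.sign π : ℤ) * labelDet E r c :=
  Matrix.det_permute π (Matrix.of fun i j => E (r i) (c j))

/-- Minors that contain an invertible principal block are multiples of the minors of its Schur
complement. -/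
lemma det_submatrix_sumMap {m q p : Type*} [Fintype m] [DecidableEq m] [Fintype p] [DecidableEq p]
    (K : Matrix m m ℝ) (U : Matrix m q ℝ) (V : Matrix q m ℝ) (D : Matrix q q ℝ)
    (hK : IsUnit K.det) (r c : p → q) :
    ((Matrix.fromBlocks K U V D).submatrix (Sum.map id r) (Sum.map id c)).det =
      K.det * ((D - V * K⁻¹ * U).submatrix r c).det := by
  have : Invertible K := Matrix.invertibleOfIsUnitDet K hK
  have h : (Matrix.fromBlocks K U V D).submatrix (Sum.map id r) (Sum.map id c) =
      Matrix.fromBlocks K (U.submatrix id c) (V.submatrix r id) (D.submatrix r c) := by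
    ext (i | i) (j | j) <;> rfl
  rw [h, Matrix.det_fromBlocks₁₁, Matrix.invOf_eq_nonsing_inv]
  rfl

/-- The defect of the three-by-three bordered minor identity. -/
noncomputable def minorDefect {m : Type*} [Fintype m] [DecidableEq m]
    (B : Matrix (m ⊕ Fin 3) (m ⊕ Fin 3) ℝ) : ℝ :=
  (B.submatrix (Sum.map id ![0]) (Sum.map id ![0])).det *
      (B.submatrix (Sum.map id ![1, 2]) (Sum.map id ![1, 2])).det -
    (B.submatrix (Sum.map id ![0, 1]) (Sum.map id ![0, 1])).det *
      (B.submatrix (Sum.map id ![2]) (Sum.map id ![2])).det -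
    ((B.submatrix (Sum.map id ![0, 2]) (Sum.map id ![1, 2])).det *
      (B.submatrix (Sum.map id ![0]) (Sum.map id ![1])).det -
    (B.submatrix (Sum.map id ![1]) (Sum.map id ![2])).det *
      (B.submatrix (Sum.map id ![0, 1]) (Sum.map id ![0, 2])).det)

lemma minorDefect_of_isUnit {m : Type*} [Fintype m] [DecidableEq m]
    (K : Matrix m m ℝ) (U : Matrix m (Fin 3) ℝ) (D : Matrix (Fin 3) (Fin 3) ℝ)
    (hKs : K.IsSymm) (hD : D.IsSymm) (hK : IsUnit K.det) :
    minorDefect (Matrix.fromBlocks K U U.transpose D) = 0 := by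
  have hS : (D - U.transpose * K⁻¹ * U).IsSymm := by
    unfold Matrix.IsSymm
    rw [Matrix.transpose_sub, Matrix.transpose_mul, Matrix.transpose_mul,
      Matrix.transpose_transpose, Matrix.transpose_nonsing_inv, hKs.eq, hD.eq, Matrix.mul_assoc]
  unfold minorDefect
  simp only [det_submatrix_sumMap _ _ _ _ hK]
  generalize D - U.transpose * K⁻¹ * U = S at hS
  have h10 := hS.apply 0 1
  have h21 := hS.apply 1 2
  simp only [Matrix.det_fin_two, Matrix.det_fin_one, Matrix.submatrix_apply]
  simp only [Matrix.cons_val, h10, h21]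
  ring

lemma dense_det_add_smul_one_ne_zero {m : Type*} [Fintype m] [DecidableEq m]
    (K : Matrix m m ℝ) : Dense {x : ℝ | (K + x • (1 : Matrix m m ℝ)).det ≠ 0} := by
  have hne : (-K).charpoly ≠ 0 := (Matrix.charpoly_monic (-K)).ne_zero
  have hfin : {x : ℝ | (-K).charpoly.IsRoot x}.Finite := Polynomial.finite_setOfPred_isRoot hne
  refine (hfin.countable.dense_compl ℝ).mono fun x hx => ?_
  simp only [Set.mem_compl_iff, Set.mem_ofPred_eq, Polynomial.IsRoot.def, Matrix.eval_charpoly] at hx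
  rwa [sub_neg_eq_add, add_comm, Matrix.scalar_apply, ← Matrix.smul_one_eq_diagonal] at hx

lemma minorDefect_eq_zero {m : Type*} [Fintype m] [DecidableEq m]
    (B : Matrix (m ⊕ Fin 3) (m ⊕ Fin 3) ℝ) (hB : B.IsSymm) : minorDefect B = 0 := by
  obtain ⟨hK, hUV, -, hD⟩ := Matrix.isSymm_fromBlocks_iff.1
    ((Matrix.fromBlocks_toBlocks B).symm ▸ hB)
  set K := B.toBlocks₁₁
  set U := B.toBlocks₁₂
  let F : ℝ → Matrix (m ⊕ Fin 3) (m ⊕ Fin 3) ℝ := fun x =>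
    Matrix.fromBlocks (K + x • (1 : Matrix m m ℝ)) U U.transpose B.toBlocks₂₂
  have hF : Continuous F := by
    refine Continuous.matrix_fromBlocks ?_ ?_ ?_ ?_ <;> fun_prop
  have hcont : Continuous fun x => minorDefect (F x) := by
    unfold minorDefect
    fun_prop
  have hzero : (fun x => minorDefect (F x)) = fun _ => (0 : ℝ) := by
    refine hcont.ext_on (dense_det_add_smul_one_ne_zero K) continuous_const fun x hx => ?_
    refine minorDefect_of_isUnit _ _ _ ?_ hD (isUnit_iff_ne_zero.2 hx)
    exact hK.add (Matrix.isSymm_one.smul x)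
  have h0 := congrFun hzero 0
  have hF0 : F 0 = B := by
    simp only [F, zero_smul, add_zero]
    rw [hUV]
    exact Matrix.fromBlocks_toBlocks B
  simpa [hF0] using h0

lemma det_sub_mul_eq_labelDet {α ι : Type*} [Fintype ι] [DecidableEq ι]
    (E : α → α → ℝ) (z : α) (hz : E z z = 1) (r c : ι → α) :
    Matrix.det (Matrix.of fun i j => E (r i) (c j) - E (r i) z * E z (c j)) =
      labelDet E (Sum.elim r fun _ : Fin 1 => z) (Sum.elim c fun _ : Fin 1 => z) := by
  have h : (Matrix.of fun i j => E (Sum.elim r (fun _ : Fin 1 => z) i)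
      (Sum.elim c (fun _ : Fin 1 => z) j)) =
      Matrix.fromBlocks (Matrix.of fun i j => E (r i) (c j))
        (Matrix.of fun i (_ : Fin 1) => E (r i) z) (Matrix.of fun (_ : Fin 1) j => E z (c j)) 1 := by
    ext (i | i) (j | j)
    · rfl
    · rfl
    · rfl
    · simp [hz, Subsingleton.elim i j]
  rw [labelDet, h, Matrix.det_fromBlocks_one₂₂]
  congr 1
  ext i j
  simp [Matrix.mul_apply]

/-- The bordered minor identity in terms of a symmetric kernel. -/
lemma labelDet_identity {α m : Type*} [Fintype m] [DecidableEq m]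
    (E : α → α → ℝ) (hE : ∀ a b, E a b = E b a) (k : m → α) (a b z : α) :
    labelDet E (Sum.elim k ![a]) (Sum.elim k ![a]) *
        labelDet E (Sum.elim k ![b, z]) (Sum.elim k ![b, z]) -
      labelDet E (Sum.elim k ![a, b]) (Sum.elim k ![a, b]) *
        labelDet E (Sum.elim k ![z]) (Sum.elim k ![z]) =
      labelDet E (Sum.elim k ![a, z]) (Sum.elim k ![b, z]) *
        labelDet E (Sum.elim k ![a]) (Sum.elim k ![b]) -
      labelDet E (Sum.elim k ![b]) (Sum.elim k ![z]) *
        labelDet E (Sum.elim k ![a, b]) (Sum.elim k ![a, z]) := by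
  let l : m ⊕ Fin 3 → α := Sum.elim k ![a, b, z]
  have h := minorDefect_eq_zero (Matrix.of fun i j => E (l i) (l j))
    (Matrix.IsSymm.ext fun i j => hE _ _)
  have hsub {p : Type} [Fintype p] [DecidableEq p] (r c : p → Fin 3) :
      ((Matrix.of fun i j => E (l i) (l j)).submatrix (Sum.map id r) (Sum.map id c)).det =
        labelDet E (Sum.elim k (![a, b, z] ∘ r)) (Sum.elim k (![a, b, z] ∘ c)) := by
    unfold labelDet
    congr 1
    ext (i | i) (j | j) <;> rfl
  unfold minorDefect at h
  simp only [hsub] at h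
  have hone (p : Fin 3) : ![a, b, z] ∘ ![p] = ![![a, b, z] p] := by
    ext1 i
    fin_cases i
    rfl
  have htwo (p q : Fin 3) : ![a, b, z] ∘ ![p, q] = ![![a, b, z] p, ![a, b, z] q] := by
    ext1 i
    fin_cases i <;> rfl
  simp only [hone, htwo] at h
  exact sub_eq_zero.1 h

lemma mom_comm (s t i j : ℕ) : mom s t i j = mom s t j i := by
  unfold mom
  rw [Measure.volume_eq_prod, ← setIntegral_prod_swap]
  refine setIntegral_congr_fun (measurableSet_Ioo.prod measurableSet_Ioo) fun p _ => ?_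
  simp only [Prod.fst_swap, Prod.snd_swap, add_comm p.2 p.1]
  ring

lemma mom_add_one (s t i j : ℕ) : mom (s + 1) t i j = mom s t (i + 1) (j + 1) := by
  simp only [mom, add_assoc, add_comm 1]

lemma phi_add_one (s t i : ℕ) : phi (s + 1) t i = phi s t (i + 1) := by
  simp only [phi, add_assoc, add_comm 1]

lemma div_one_add_mem_Icc {x : ℝ} (hx : x ∈ Set.Ioo (0 : ℝ) 1) :
    (1 - x) / (1 + x) ∈ Set.Icc (0 : ℝ) 1 := by
  obtain ⟨h0, h1⟩ := hx
  constructor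
  · apply div_nonneg <;> linarith
  · rw [div_le_one (by linarith)]
    linarith

lemma inv_add_le_rpow_mul_rpow {x y : ℝ} (hx : 0 < x) (hy : 0 < y) :
    (x + y)⁻¹ ≤ x ^ (-(1 / 2) : ℝ) * y ^ (-(1 / 2) : ℝ) := by
  rw [Real.rpow_neg hx.le, Real.rpow_neg hy.le, ← Real.sqrt_eq_rpow, ← Real.sqrt_eq_rpow,
    ← mul_inv]
  have h1 := Real.sqrt_pos.2 hx
  have h2 := Real.sqrt_pos.2 hy
  apply inv_anti₀ (by positivity)
  nlinarith [Real.sq_sqrt hx.le, Real.sq_sqrt hy.le, sq_nonneg (√x - √y)]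

lemma integrableOn_mom (s t i j : ℕ) :
    IntegrableOn (fun p : ℝ × ℝ => (p.1 ^ (s + i) * p.2 ^ (s + j) / (p.1 + p.2)) *
      ((1 - p.1) / (1 + p.1)) ^ t * ((1 - p.2) / (1 + p.2)) ^ t)
      (Set.Ioo (0:ℝ) 1 ×ˢ Set.Ioo (0:ℝ) 1) := by
  have hI : IntegrableOn (fun x : ℝ => x ^ (-(1 / 2) : ℝ)) (Set.Ioo 0 1) :=
    (intervalIntegral.integrableOn_Ioo_rpow_iff one_pos).2 (by norm_num)
  have hprod : IntegrableOn (fun p : ℝ × ℝ => p.1 ^ (-(1 / 2) : ℝ) * p.2 ^ (-(1 / 2) : ℝ))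
      (Set.Ioo (0:ℝ) 1 ×ˢ Set.Ioo (0:ℝ) 1) := by
    rw [IntegrableOn, Measure.volume_eq_prod, ← Measure.prod_restrict]
    exact hI.mul_prod hI
  refine hprod.mono' (by fun_prop) ?_
  refine (ae_restrict_iff' (measurableSet_Ioo.prod measurableSet_Ioo)).2
    (Filter.Eventually.of_forall ?_)
  rintro ⟨x, y⟩ ⟨hx, hy⟩
  simp only at hx hy
  obtain ⟨hx0, hx1⟩ := div_one_add_mem_Icc hx
  obtain ⟨hy0, hy1⟩ := div_one_add_mem_Icc hy
  have hX := pow_le_one₀ (n := s + i) hx.1.le hx.2.le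
  have hY := pow_le_one₀ (n := s + j) hy.1.le hy.2.le
  have hT := pow_le_one₀ (n := t) hx0 hx1
  have hT' := pow_le_one₀ (n := t) hy0 hy1
  have hpx := hx.1
  have hpy := hy.1
  have hsum : 0 < (x + y)⁻¹ := by positivity
  have hXY : x ^ (s + i) * y ^ (s + j) ≤ 1 := mul_le_one₀ hX (by positivity) hY
  have hnum : x ^ (s + i) * y ^ (s + j) * (((1 - x) / (1 + x)) ^ t * ((1 - y) / (1 + y)) ^ t) ≤ 1 :=
    mul_le_one₀ hXY (by positivity) (mul_le_one₀ hT (by positivity) hT')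
  rw [Real.norm_of_nonneg (by positivity)]
  calc _ = x ^ (s + i) * y ^ (s + j) * (((1 - x) / (1 + x)) ^ t * ((1 - y) / (1 + y)) ^ t) *
        (x + y)⁻¹ := by ring
    _ ≤ 1 * (x + y)⁻¹ := by gcongr
    _ ≤ _ := by simpa using inv_add_le_rpow_mul_rpow hpx hpy

lemma mom_sub_mom_add_one (s t i j : ℕ) :
    mom s (t + 1) i j = mom s t i j - phi s t i * phi s t j := by
  have hphi : phi s t i * phi s t j =
      ∫ p in (Set.Ioo (0:ℝ) 1 ×ˢ Set.Ioo (0:ℝ) 1),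
        2 * (((p.1 ^ (s + i) / (1 + p.1)) * ((1 - p.1) / (1 + p.1)) ^ t) *
          ((p.2 ^ (s + j) / (1 + p.2)) * ((1 - p.2) / (1 + p.2)) ^ t)) := by
    rw [integral_const_mul, Measure.volume_eq_prod,
      setIntegral_prod_mul (fun x : ℝ => (x ^ (s + i) / (1 + x)) * ((1 - x) / (1 + x)) ^ t)
        (fun y : ℝ => (y ^ (s + j) / (1 + y)) * ((1 - y) / (1 + y)) ^ t)]
    unfold phi
    rw [mul_mul_mul_comm, Real.mul_self_sqrt zero_le_two]
  rw [eq_sub_iff_add_eq', ← eq_sub_iff_add_eq, hphi]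
  unfold mom
  rw [← integral_sub (integrableOn_mom s t i j) (integrableOn_mom s (t + 1) i j)]
  refine setIntegral_congr_fun (measurableSet_Ioo.prod measurableSet_Ioo) ?_
  rintro ⟨x, y⟩ ⟨hx, hy⟩
  have h1 := hx.1
  have h2 := hy.1
  simp only at h1 h2 ⊢
  rw [pow_succ, pow_succ]
  generalize ((1 - x) / (1 + x)) ^ t = u
  generalize ((1 - y) / (1 + y)) ^ t = v
  field_simp
  ring

/-- The bimoments bordered by the single moments `φ` and a corner entry `1`, the border being
labelled by `none`. -/
noncomputable def borderedMom (s t : ℕ) : Option ℕ → Option ℕ → ℝ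
  | some i, some j => mom s t i j
  | some i, none => phi s t i
  | none, some j => phi s t j
  | none, none => 1

lemma borderedMom_comm (s t : ℕ) (a b : Option ℕ) :
    borderedMom s t a b = borderedMom s t b a := by
  rcases a with _ | i <;> rcases b with _ | j <;> first | rfl | exact mom_comm s t i j

/-- The enumeration of `Fin (m + 1)` that lists `0` last. -/
def finSumFinOneRotate (m : ℕ) : Fin m ⊕ Fin 1 ≃ Fin (m + 1) :=
  (Equiv.sumComm _ _).trans (finSumFinEquiv.trans (finCongr (Nat.add_comm 1 m)))

@[simp]
lemma val_finSumFinOneRotate_inl (m : ℕ) (i : Fin m) :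
    (finSumFinOneRotate m (Sum.inl i) : ℕ) = i + 1 := by
  simp [finSumFinOneRotate]

@[simp]
lemma val_finSumFinOneRotate_inr (m : ℕ) (i : Fin 1) :
    (finSumFinOneRotate m (Sum.inr i) : ℕ) = 0 := by
  simp [finSumFinOneRotate]

/-- Regrouping of two singletons into a pair. -/
def sumFinTwoEquiv (m : Type*) : m ⊕ Fin 2 ≃ (m ⊕ Fin 1) ⊕ Fin 1 :=
  ((Equiv.sumAssoc _ _ _).trans
    (Equiv.sumCongr (Equiv.refl m) (finSumFinEquiv (m := 1) (n := 1)))).symm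

@[simp]
lemma sumFinTwoEquiv_inl {m : Type*} (i : m) :
    sumFinTwoEquiv m (Sum.inl i) = Sum.inl (Sum.inl i) := rfl

@[simp]
lemma sumFinTwoEquiv_inr_zero {m : Type*} :
    sumFinTwoEquiv m (Sum.inr 0) = Sum.inl (Sum.inr 0) := rfl

@[simp]
lemma sumFinTwoEquiv_inr_one {m : Type*} :
    sumFinTwoEquiv m (Sum.inr 1) = Sum.inr 0 := rfl

lemma tau_eq_labelDet (s t n : ℕ) :
    tau s t n = labelDet (borderedMom s t) (fun i : Fin n => some (i : ℕ))
      (fun i : Fin n => some (i : ℕ)) := rfl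

lemma xi_eq_labelDet (s t n : ℕ) :
    xi s t n = labelDet (borderedMom s t) (fun i : Fin n => some (i : ℕ))
      (fun i : Fin n => some ((i : ℕ) + 1)) := rfl

lemma sig_eq_labelDet (s t n : ℕ) :
    sig s t n = labelDet (borderedMom s t) (fun i : Fin (n + 1) => some (i : ℕ))
      (fun i : Fin (n + 1) => if (i : ℕ) < n then some (i : ℕ) else none) := by
  unfold sig labelDet
  congr 1
  ext i j
  simp only [Matrix.of_apply]
  split_ifs <;> rfl

lemma sig_add_one_eq_labelDet (s t n : ℕ) :
    sig (s + 1) t n = labelDet (borderedMom s t) (fun i : Fin (n + 1) => some ((i : ℕ) + 1))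
      (fun i : Fin (n + 1) => if (i : ℕ) < n then some ((i : ℕ) + 1) else none) := by
  unfold sig labelDet
  congr 1
  ext i j
  simp only [Matrix.of_apply, mom_add_one, phi_add_one]
  split_ifs <;> rfl

lemma tau_add_one_add_one_eq_labelDet (s t n : ℕ) :
    tau (s + 1) (t + 1) n = labelDet (borderedMom s t)
      (Sum.elim (fun i : Fin n => some ((i : ℕ) + 1)) fun _ : Fin 1 => none)
      (Sum.elim (fun i : Fin n => some ((i : ℕ) + 1)) fun _ : Fin 1 => none) := by
  rw [← det_sub_mul_eq_labelDet _ _ rfl]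
  unfold tau
  simp only [mom_add_one, mom_sub_mom_add_one]
  rfl

lemma xi_add_one_eq_labelDet (s t n : ℕ) :
    xi s (t + 1) n = labelDet (borderedMom s t)
      (Sum.elim (fun i : Fin n => some (i : ℕ)) fun _ : Fin 1 => none)
      (Sum.elim (fun i : Fin n => some ((i : ℕ) + 1)) fun _ : Fin 1 => none) := by
  rw [← det_sub_mul_eq_labelDet _ _ rfl]
  unfold xi
  simp only [mom_sub_mom_add_one]
  rfl

/-- Both determinants `ξ` acquire the same sign when their rows are reordered. -/
lemma xi_add_one_mul_xi (s t m : ℕ) :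
    xi s (t + 1) (m + 1) * xi s t (m + 1) =
      labelDet (borderedMom s t) (Sum.elim (fun i : Fin m => some ((i : ℕ) + 1)) ![some 0, none])
          (Sum.elim (fun i : Fin m => some ((i : ℕ) + 1)) ![some (m + 1), none]) *
        labelDet (borderedMom s t) (Sum.elim (fun i : Fin m => some ((i : ℕ) + 1)) ![some 0])
          (Sum.elim (fun i : Fin m => some ((i : ℕ) + 1)) ![some (m + 1)]) := by
  let k : Fin m → Option ℕ := fun i => some ((i : ℕ) + 1)
  let e : Fin m ⊕ Fin 1 ≃ Fin (m + 1) := finSumFinEquiv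
  let π : Equiv.Perm (Fin m ⊕ Fin 1) := e.trans (finSumFinOneRotate m).symm
  have hrow : (fun i : Fin (m + 1) => some (i : ℕ)) ∘ e = Sum.elim k ![some 0] ∘ π := by
    have h : (fun i : Fin (m + 1) => some (i : ℕ)) ∘ finSumFinOneRotate m =
        Sum.elim k ![some 0] := by
      ext1 (i | i) <;> simp [k]
    rw [← h]
    ext1 i
    simp [π]
  have hcol : (fun i : Fin (m + 1) => some ((i : ℕ) + 1)) ∘ e = Sum.elim k ![some (m + 1)] := by
    ext1 (i | i) <;> simp [k, e]
  have hxi : xi s t (m + 1) = (Equiv.Perm.sign π : ℤ) *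
      labelDet (borderedMom s t) (Sum.elim k ![some 0]) (Sum.elim k ![some (m + 1)]) := by
    rw [xi_eq_labelDet, ← labelDet_comp_equiv _ _ _ e, hrow, hcol, labelDet_comp_perm]
  have hxi' : xi s (t + 1) (m + 1) = (Equiv.Perm.sign π : ℤ) *
      labelDet (borderedMom s t) (Sum.elim k ![some 0, none])
        (Sum.elim k ![some (m + 1), none]) := by
    have hrow' : Sum.elim (fun i : Fin (m + 1) => some (i : ℕ)) (fun _ : Fin 1 => none) ∘
        Equiv.sumCongr e (Equiv.refl _) =
        Sum.elim (Sum.elim k ![some 0]) (fun _ : Fin 1 => none) ∘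
          Equiv.Perm.sumCongr π (Equiv.refl _) := by
      ext1 (i | i)
      · exact congrFun hrow i
      · rfl
    have hcol' : Sum.elim (fun i : Fin (m + 1) => some ((i : ℕ) + 1)) (fun _ : Fin 1 => none) ∘
        Equiv.sumCongr e (Equiv.refl _) =
        Sum.elim (Sum.elim k ![some (m + 1)]) (fun _ : Fin 1 => none) := by
      ext1 (i | i)
      · exact congrFun hcol i
      · rfl
    have hgroup (a : Option ℕ) : Sum.elim (Sum.elim k ![a]) (fun _ : Fin 1 => none) ∘
        sumFinTwoEquiv (Fin m) = Sum.elim k ![a, none] := by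
      ext1 (i | i)
      · rfl
      · fin_cases i <;> rfl
    rw [xi_add_one_eq_labelDet, ← labelDet_comp_equiv _ _ _ (Equiv.sumCongr e (Equiv.refl _)),
      hrow', hcol', labelDet_comp_perm, ← labelDet_comp_equiv _ _ _ (sumFinTwoEquiv (Fin m)),
      hgroup, hgroup, Equiv.Perm.sign_sumCongr, Equiv.Perm.sign_refl, mul_one]
  have hsign : ((Equiv.Perm.sign π : ℤ) : ℝ) * (Equiv.Perm.sign π : ℤ) = 1 := by
    rw [← Int.cast_mul, ← Units.val_mul, Int.units_mul_self]
    simp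
  rw [hxi, hxi', mul_mul_mul_comm, hsign, one_mul]

/-- the bilinear identity
`τ_n^{s,t}τ_n^{s+1,t+1} − τ_{n+1}^{s,t}τ_{n−1}^{s+1,t+1} = ξ_n^{s,t+1}ξ_n^{s,t} − σ_{n−1}^{s+1,t}σ_n^{s,t}`. -/
theorem bilinear_identity_III (s t n : ℕ) (hn : 1 ≤ n) :
    tau s t n * tau (s + 1) (t + 1) n - tau s t (n + 1) * tau (s + 1) (t + 1) (n - 1) =
      xi s (t + 1) n * xi s t n - sig (s + 1) t (n - 1) * sig s t n := by
  obtain ⟨m, rfl⟩ : ∃ m, n = m + 1 := ⟨n - 1, by omega⟩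
  rw [Nat.add_sub_cancel, xi_add_one_mul_xi]
  let k : Fin m → Option ℕ := fun i => some ((i : ℕ) + 1)
  let e : Fin m ⊕ Fin 1 ≃ Fin (m + 1) := finSumFinEquiv
  let e₂ : Fin m ⊕ Fin 2 ≃ Fin (m + 1 + 1) :=
    (sumFinTwoEquiv (Fin m)).trans
      ((Equiv.sumCongr (finSumFinOneRotate m) (Equiv.refl _)).trans finSumFinEquiv)
  let e₂' : Fin m ⊕ Fin 2 ≃ Fin (m + 1) ⊕ Fin 1 :=
    (sumFinTwoEquiv (Fin m)).trans (Equiv.sumCongr e (Equiv.refl _))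
  have h₁ : tau s t (m + 1) =
      labelDet (borderedMom s t) (Sum.elim k ![some 0]) (Sum.elim k ![some 0]) := by
    rw [tau_eq_labelDet, ← labelDet_comp_equiv _ _ _ (finSumFinOneRotate m)]
    congr 1 <;> ext1 (i | i) <;> simp [k]
  have h₂ : tau (s + 1) (t + 1) (m + 1) = labelDet (borderedMom s t)
      (Sum.elim k ![some (m + 1), none]) (Sum.elim k ![some (m + 1), none]) := by
    rw [tau_add_one_add_one_eq_labelDet, ← labelDet_comp_equiv _ _ _ e₂']
    have h : Sum.elim (fun i : Fin (m + 1) => some ((i : ℕ) + 1)) (fun _ : Fin 1 => none) ∘ e₂' =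
        Sum.elim k ![some (m + 1), none] := by
      ext1 (i | i)
      · simp [k, e₂', e]
      · fin_cases i <;> simp [e₂', e]
    rw [h]
  have hrow : (fun i : Fin (m + 1 + 1) => some (i : ℕ)) ∘ e₂ =
      Sum.elim k ![some 0, some (m + 1)] := by
    ext1 (i | i)
    · simp [k, e₂]
    · fin_cases i <;> simp [e₂]
  have h₃ : tau s t (m + 1 + 1) = labelDet (borderedMom s t)
      (Sum.elim k ![some 0, some (m + 1)]) (Sum.elim k ![some 0, some (m + 1)]) := by
    rw [tau_eq_labelDet, ← labelDet_comp_equiv _ _ _ e₂, hrow]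
  have h₄ : tau (s + 1) (t + 1) m =
      labelDet (borderedMom s t) (Sum.elim k ![none]) (Sum.elim k ![none]) := by
    rw [tau_add_one_add_one_eq_labelDet]
    congr 1 <;> ext1 (i | i) <;> simp [k]
  have h₅ : sig (s + 1) t m =
      labelDet (borderedMom s t) (Sum.elim k ![some (m + 1)]) (Sum.elim k ![none]) := by
    rw [sig_add_one_eq_labelDet, ← labelDet_comp_equiv _ _ _ e]
    congr 1 <;> ext1 (i | i) <;> simp [k, e]
  have h₆ : sig s t (m + 1) = labelDet (borderedMom s t)
      (Sum.elim k ![some 0, some (m + 1)]) (Sum.elim k ![some 0, none]) := by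
    rw [sig_eq_labelDet, ← labelDet_comp_equiv _ _ _ e₂, hrow]
    congr 1
    ext1 (i | i)
    · simp [k, e₂]
    · fin_cases i <;> simp [e₂]
  rw [h₁, h₂, h₃, h₄, h₅, h₆]
  exact labelDet_identity (borderedMom s t) (borderedMom_comm s t) k _ _ _
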